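/- arXiv:1503.02895 — 2 statements merged into one kernel-verified Lean document; each statement's English description precedes it below -/
import Mathlib

section
/- Let X = (X,Σ,μ) and X' = (X',Σ',μ') be probability spaces and let Φ : L¹(X) → L¹(X') be a Markov embedding, i.e. a linear isometry which is a lattice homomorphism (|Φf| = Φ|f| for all f ∈ L¹(X)) and satisfies Φ𝟙 = 𝟙. Then: (a) Φ maps L^∞(X) into L^∞(X') and restricts there to an embedding of C*-algebras; in particular Φ(fg) = (Φf)·(Φg) and Φ(conj f) = conj(Φf) for all f, g ∈ L^∞(X), and ‖Φf‖_∞ = ‖f‖_∞; (b) for every f ∈ L¹(X), μ{ |f| > 0 } = μ'{ |Φf| > 0 }; in particular, {f = 0} is a μ-null set if and only if {Φf = 0} is a μ'-null set. -/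
open MeasureTheory ComplexConjugate
open scoped ENNReal

noncomputable section

section MarkovEmbedding

variable {X : Type*} [MeasurableSpace X] {μ : Measure X}
  {X' : Type*} [MeasurableSpace X'] {μ' : Measure X'}

/-- The modulus `|f|` of `f ∈ L¹`, again as an element of the complex space `L¹`. -/
def absL1 (f : Lp ℂ 1 μ) : Lp ℂ 1 μ :=
  ((Lp.memLp f).norm.ofReal (K := ℂ)).toLp

lemma coeFn_absL1 (f : Lp ℂ 1 μ) : ⇑(absL1 f) =ᵐ[μ] fun x => (‖f x‖ : ℂ) :=
  MemLp.coeFn_toLp _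

lemma ae_eq_norm_iff {f : X → ℂ} {r : X → ℝ} (h : ∀ᵐ x ∂μ, f x = r x) :
    (f =ᵐ[μ] fun x => (‖f x‖ : ℂ)) ↔ ∀ᵐ x ∂μ, 0 ≤ r x := by
  refine ⟨fun H => ?_, fun H => ?_⟩
  · filter_upwards [h, H] with x hx hy
    rw [hx] at hy
    rw [Complex.ofReal_inj.1 hy]
    exact norm_nonneg _
  · filter_upwards [h, H] with x hx hy
    rw [hx, Complex.norm_real, Real.norm_of_nonneg hy]

lemma eLpNorm_top_le_coe_iff (f : X → ℂ) (C : NNReal) :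
    eLpNorm f ⊤ μ ≤ C ↔ ∀ᵐ x ∂μ, ‖f x‖ ≤ C := by
  rw [eLpNorm_exponent_top]
  refine ⟨fun h => ?_, fun h => eLpNormEssSup_le_of_ae_nnnorm_bound h⟩
  filter_upwards [ae_le_eLpNormEssSup (f := f) (μ := μ)] with x hx
  exact_mod_cast (enorm_le_coe.1 (hx.trans h) : ‖f x‖₊ ≤ C)

lemma min_one_eq_norm (t : ℝ) : min t 1 = (1 + t - ‖(1 : ℂ) - t‖) / 2 := by
  rw [← Complex.ofReal_one, ← Complex.ofReal_sub, Complex.norm_real, Real.norm_eq_abs]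
  rcases le_total t 1 with h | h
  · rw [min_eq_left h, abs_of_nonneg (by linarith)]; ring
  · rw [min_eq_right h, abs_of_nonpos (by linarith)]; ring

lemma integral_min_one_eq [IsProbabilityMeasure μ] (n : ℕ) (u v : Lp ℂ 1 μ)
    (hv : ⇑v =ᵐ[μ] fun x => (1 - (n * ‖u x‖ : ℝ) : ℂ)) :
    ∫ x, min (n * ‖u x‖) 1 ∂μ = (1 + n * ‖u‖ - ‖v‖) / 2 := by
  have hu := (L1.integrable_coeFn u).norm.const_mul (n : ℝ)
  have hv' : (fun x => ‖(1 : ℂ) - (n * ‖u x‖ : ℝ)‖) =ᵐ[μ] fun x => ‖v x‖ := by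
    filter_upwards [hv] with x hx
    rw [hx]
  simp_rw [min_one_eq_norm]
  rw [integral_div, integral_sub _ ((L1.integrable_coeFn v).norm.congr hv'.symm),
    integral_congr_ae hv', integral_add (integrable_const 1) hu, integral_const_mul,
    L1.norm_eq_integral_norm, L1.norm_eq_integral_norm]
  · simp
  · exact (integrable_const 1).add hu

lemma tendsto_integral_min_one [IsProbabilityMeasure μ] (f : Lp ℂ 1 μ) :
    Filter.Tendsto (fun n : ℕ => ∫ x, min (n * ‖f x‖) 1 ∂μ) Filter.atTop
      (nhds (μ.real {x | f x ≠ 0})) := by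
  have hf := (Lp.stronglyMeasurable f).measurable
  have hs : MeasurableSet {x | f x ≠ 0} := (hf (measurableSet_singleton 0)).compl
  rw [← integral_indicator_one hs]
  refine tendsto_integral_of_dominated_convergence (fun _ => 1) (fun n => ?_)
    (integrable_const 1) (fun n => .of_forall fun x => ?_) (.of_forall fun x => ?_)
  · exact ((hf.norm.const_mul _).min measurable_const).aestronglyMeasurable
  · rw [Real.norm_of_nonneg (by positivity)]
    exact min_le_right _ _
  · by_cases hx : f x = 0
    · simp [hx]
    · rw [Set.indicator_of_mem (by exact hx)]
      refine tendsto_const_nhds.congr' ?_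
      have := (tendsto_natCast_atTop_atTop (R := ℝ)).atTop_mul_const (norm_pos_iff.2 hx)
      filter_upwards [this.eventually_ge_atTop 1] with n hn
      simp [min_eq_right hn]

lemma measure_ne_zero_eq_one_iff [IsProbabilityMeasure μ] (f : Lp ℂ 1 μ) :
    μ {x | f x = 0} = 0 ↔ μ {x | f x ≠ 0} = 1 := by
  have hs : MeasurableSet {x | f x ≠ 0} :=
    ((Lp.stronglyMeasurable f).measurable (measurableSet_singleton 0)).compl
  rw [← prob_compl_eq_zero_iff hs]
  simp [Set.compl_ofPred]

/-- A Markov embedding: a linear isometry `L¹(X) → L¹(X')` which is a lattice homomorphism and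
maps the constant function one to the constant function one. -/
structure IsMarkovEmbedding (Φ : Lp ℂ 1 μ →ₗ[ℂ] Lp ℂ 1 μ') : Prop where
  norm_map (f : Lp ℂ 1 μ) : ‖Φ f‖ = ‖f‖
  map_norm (f g : Lp ℂ 1 μ) : (⇑g =ᵐ[μ] fun x => (‖f x‖ : ℂ)) →
    ⇑(Φ g) =ᵐ[μ'] fun x => (‖Φ f x‖ : ℂ)
  map_one (e : Lp ℂ 1 μ) : (⇑e =ᵐ[μ] fun _ => (1 : ℂ)) → ⇑(Φ e) =ᵐ[μ'] fun _ => (1 : ℂ)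

namespace IsMarkovEmbedding

variable {Φ : Lp ℂ 1 μ →ₗ[ℂ] Lp ℂ 1 μ'}

lemma injective (hΦ : IsMarkovEmbedding Φ) : Function.Injective Φ :=
  (AddMonoidHomClass.isometry_of_norm Φ hΦ.norm_map).injective

lemma map_absL1 (hΦ : IsMarkovEmbedding Φ) (f : Lp ℂ 1 μ) : Φ (absL1 f) = absL1 (Φ f) :=
  Lp.ext ((hΦ.map_norm f _ (coeFn_absL1 f)).trans (coeFn_absL1 _).symm)

lemma coeFn_map_eq_norm_iff (hΦ : IsMarkovEmbedding Φ) (f : Lp ℂ 1 μ) :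
    (⇑(Φ f) =ᵐ[μ'] fun x => (‖Φ f x‖ : ℂ)) ↔ ⇑f =ᵐ[μ] fun x => (‖f x‖ : ℂ) := by
  refine ⟨fun h => ?_, fun h => hΦ.map_norm f f h⟩
  have h' : f = absL1 f := hΦ.injective <| by
    rw [hΦ.map_absL1]
    exact Lp.ext (h.trans (coeFn_absL1 _).symm)
  simpa only [← h'] using coeFn_absL1 f

lemma map_mul_eq_zero (hΦ : IsMarkovEmbedding Φ) {f g : Lp ℂ 1 μ} (h : ∀ᵐ x ∂μ, f x * g x = 0) :
    ∀ᵐ x ∂μ', Φ f x * Φ g x = 0 := by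
  have key := hΦ.map_norm (absL1 f - absL1 g) (absL1 f + absL1 g) (by
    filter_upwards [h, coeFn_absL1 f, coeFn_absL1 g, Lp.coeFn_sub (absL1 f) (absL1 g),
      Lp.coeFn_add (absL1 f) (absL1 g)] with x hx hf hg hs ha
    rw [hs, ha, Pi.sub_apply, Pi.add_apply, hf, hg]
    rcases mul_eq_zero.1 hx with h | h <;> simp [h])
  rw [map_add, map_sub, hΦ.map_absL1, hΦ.map_absL1] at key
  filter_upwards [key, coeFn_absL1 (Φ f), coeFn_absL1 (Φ g),
    Lp.coeFn_sub (absL1 (Φ f)) (absL1 (Φ g)),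
    Lp.coeFn_add (absL1 (Φ f)) (absL1 (Φ g))] with x hx hf hg hs ha
  rw [hs, ha, Pi.sub_apply, Pi.add_apply, hf, hg, ← Complex.ofReal_sub, Complex.norm_real,
    ← Complex.ofReal_add, Complex.ofReal_inj, Real.norm_eq_abs] at hx
  rw [mul_eq_zero, ← norm_eq_zero, ← norm_eq_zero (a := Φ g x)]
  rcases abs_cases (‖Φ f x‖ - ‖Φ g x‖) with h | h
  · right; linarith
  · left; linarith

lemma map_conj (hΦ : IsMarkovEmbedding Φ) {f h : Lp ℂ 1 μ} (hh : ⇑h =ᵐ[μ] fun x => conj (f x)) :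
    ⇑(Φ h) =ᵐ[μ'] fun x => conj (Φ f x) := by
  have real_map (u : Lp ℂ 1 μ) (hu : ∀ᵐ x ∂μ, (u x).im = 0) : ∀ᵐ x ∂μ', (Φ u x).im = 0 := by
    have key := (hΦ.coeFn_map_eq_norm_iff (absL1 u - u)).2 <| by
      refine (ae_eq_norm_iff (r := fun x => ‖u x‖ - (u x).re) ?_).2
        (.of_forall fun x => sub_nonneg.2 (Complex.re_le_norm _))
      filter_upwards [hu, coeFn_absL1 u, Lp.coeFn_sub (absL1 u) u] with x hx ha hs
      rw [hs, Pi.sub_apply, ha]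
      apply Complex.ext <;> simp [hx]
    rw [map_sub, hΦ.map_absL1] at key
    filter_upwards [key, coeFn_absL1 (Φ u), Lp.coeFn_sub (absL1 (Φ u)) (Φ u)] with x hx ha hs
    have := congrArg Complex.im hx
    rw [Complex.ofReal_im, hs, Pi.sub_apply, ha] at this
    simpa using this
  have h1 := real_map (f + h) <| by
    filter_upwards [hh, Lp.coeFn_add f h] with x hx ha
    simp only [ha, hx, Pi.add_apply]
    simp
  have h2 := real_map (Complex.I • (f - h)) <| by
    filter_upwards [hh, Lp.coeFn_sub f h, Lp.coeFn_smul Complex.I (f - h)] with x hx ha hs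
    simp only [hs, ha, hx, Pi.sub_apply, Pi.smul_apply]
    simp
  rw [map_add] at h1
  rw [map_smul, map_sub] at h2
  filter_upwards [h1, h2, Lp.coeFn_add (Φ f) (Φ h), Lp.coeFn_sub (Φ f) (Φ h),
    Lp.coeFn_smul Complex.I (Φ f - Φ h)] with x h1 h2 ha hs hm
  rw [ha] at h1
  rw [hm, Pi.smul_apply, hs] at h2
  simp at h1 h2
  apply Complex.ext
  · simp; linarith
  · simp; linarith

variable [IsProbabilityMeasure μ]

lemma coeFn_map_const (hΦ : IsMarkovEmbedding Φ) (c : ℂ) :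
    ⇑(Φ (Lp.const 1 μ c)) =ᵐ[μ'] fun _ => c := by
  have h : Lp.const 1 μ c = c • Lp.const 1 μ (1 : ℂ) := by
    apply Lp.ext
    filter_upwards [Lp.coeFn_const 1 μ c, Lp.coeFn_const 1 μ (1 : ℂ),
      Lp.coeFn_smul c (Lp.const 1 μ (1 : ℂ))] with x h1 h2 h3
    simp only [h1, h2, h3, Pi.smul_apply, Function.const_apply, smul_eq_mul, mul_one]
  rw [h, map_smul]
  filter_upwards [hΦ.map_one _ (Lp.coeFn_const 1 μ (1 : ℂ)),
    Lp.coeFn_smul c (Φ (Lp.const 1 μ (1 : ℂ)))] with x h1 h2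
  simp [h1, h2]

lemma ae_norm_map_le_iff (hΦ : IsMarkovEmbedding Φ) (f : Lp ℂ 1 μ) (C : ℝ) :
    (∀ᵐ x ∂μ', ‖Φ f x‖ ≤ C) ↔ ∀ᵐ x ∂μ, ‖f x‖ ≤ C := by
  have key := hΦ.coeFn_map_eq_norm_iff (Lp.const 1 μ (C : ℂ) - absL1 f)
  rw [ae_eq_norm_iff (r := fun x => C - ‖f x‖),
    ae_eq_norm_iff (r := fun x => C - ‖Φ f x‖)] at key
  · simpa only [sub_nonneg] using key
  · rw [map_sub, hΦ.map_absL1]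
    filter_upwards [Lp.coeFn_sub (Φ (Lp.const 1 μ (C : ℂ))) (absL1 (Φ f)),
      hΦ.coeFn_map_const C, coeFn_absL1 (Φ f)] with x h1 h2 h3
    simp only [h1, h2, h3, Pi.sub_apply, Complex.ofReal_sub]
  · filter_upwards [Lp.coeFn_sub (Lp.const 1 μ (C : ℂ)) (absL1 f),
      Lp.coeFn_const 1 μ (C : ℂ), coeFn_absL1 f] with x h1 h2 h3
    simp only [h1, h2, h3, Pi.sub_apply, Function.const_apply, Complex.ofReal_sub]

lemma eLpNorm_top_map (hΦ : IsMarkovEmbedding Φ) (f : Lp ℂ 1 μ) :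
    eLpNorm (⇑(Φ f)) ⊤ μ' = eLpNorm (⇑f) ⊤ μ := by
  refine eq_of_forall_ge_iff fun C => ?_
  induction C with
  | top => simp
  | coe C => rw [eLpNorm_top_le_coe_iff, eLpNorm_top_le_coe_iff, hΦ.ae_norm_map_le_iff]

lemma map_mul_indicator (hΦ : IsMarkovEmbedding Φ) {f g h : Lp ℂ 1 μ} {c : ℂ} {s : Set X}
    (hf : ⇑f =ᵐ[μ] s.indicator fun _ => c) (hh : ⇑h =ᵐ[μ] fun x => f x * g x) :
    ⇑(Φ h) =ᵐ[μ'] fun x => Φ f x * Φ g x := by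
  have h1 := hΦ.map_mul_eq_zero (f := f) (g := c • g - h) <| by
    filter_upwards [hf, hh, Lp.coeFn_sub (c • g) h, Lp.coeFn_smul c g] with x h1 h2 h3 h4
    simp only [h1, h2, h3, h4, Pi.sub_apply, Pi.smul_apply]
    by_cases hx : x ∈ s <;> simp [hx]
  have h2 := hΦ.map_mul_eq_zero (f := Lp.const 1 μ c - f) (g := h) <| by
    filter_upwards [hf, hh, Lp.coeFn_sub (Lp.const 1 μ c) f, Lp.coeFn_const 1 μ c]
      with x h1 h2 h3 h4
    simp only [h1, h2, h3, h4, Pi.sub_apply, Function.const_apply]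
    by_cases hx : x ∈ s <;> simp [hx]
  rw [map_sub] at h2
  rw [map_sub, map_smul] at h1
  rcases eq_or_ne c 0 with rfl | hc
  · have hf0 : f = 0 := Lp.ext <| by
      filter_upwards [hf, Lp.coeFn_zero ℂ 1 μ] with x h1 h2
      rw [h1, h2, Set.indicator_zero, Pi.zero_apply]
    have hh0 : h = 0 := Lp.ext <| by
      filter_upwards [hf, hh, Lp.coeFn_zero ℂ 1 μ] with x h1 h2 h3
      rw [h2, h1, h3, Set.indicator_zero, zero_mul, Pi.zero_apply]
    rw [hf0, hh0, map_zero]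
    filter_upwards [Lp.coeFn_zero ℂ 1 μ'] with x hx
    rw [hx, Pi.zero_apply, zero_mul]
  · filter_upwards [h1, h2, Lp.coeFn_sub (c • Φ g) (Φ h), Lp.coeFn_smul c (Φ g),
      Lp.coeFn_sub (Φ (Lp.const 1 μ c)) (Φ f), hΦ.coeFn_map_const c] with x h1 h2 h3 h4 h5 h6
    simp only [h3, h4, h5, h6, Pi.sub_apply, Pi.smul_apply, smul_eq_mul] at h1 h2
    exact mul_left_cancel₀ hc (by linear_combination h2 - h1)

lemma map_mul (hΦ : IsMarkovEmbedding Φ) {f g h : Lp ℂ 1 μ} (hg : eLpNorm (⇑g) ⊤ μ < ⊤)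
    (hh : ⇑h =ᵐ[μ] fun x => f x * g x) :
    ⇑(Φ h) =ᵐ[μ'] fun x => Φ f x * Φ g x := by
  have hgm : MemLp g ⊤ μ := ⟨Lp.aestronglyMeasurable g, hg⟩
  have hgm' : MemLp (Φ g) ⊤ μ' :=
    ⟨Lp.aestronglyMeasurable _, by rwa [hΦ.eLpNorm_top_map]⟩
  let M := (ContinuousLinearMap.mul ℂ ℂ).holderL μ ⊤ 1 1 hgm.toLp
  let M' := (ContinuousLinearMap.mul ℂ ℂ).holderL μ' ⊤ 1 1 hgm'.toLp
  have hM (u : Lp ℂ 1 μ) : ⇑(M u) =ᵐ[μ] fun x => u x * g x := by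
    filter_upwards [(ContinuousLinearMap.mul ℂ ℂ).coeFn_holder (r := 1) hgm.toLp u,
      hgm.coeFn_toLp] with x h1 h2
    exact h1.trans (by rw [h2, ContinuousLinearMap.mul_apply', mul_comm])
  have hM' (u : Lp ℂ 1 μ') : ⇑(M' u) =ᵐ[μ'] fun x => u x * Φ g x := by
    filter_upwards [(ContinuousLinearMap.mul ℂ ℂ).coeFn_holder (r := 1) hgm'.toLp u,
      hgm'.coeFn_toLp] with x h1 h2
    exact h1.trans (by rw [h2, ContinuousLinearMap.mul_apply', mul_comm])
  have hc : Continuous Φ := (AddMonoidHomClass.isometry_of_norm Φ hΦ.norm_map).continuous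
  have key : ∀ u : Lp ℂ 1 μ, Φ (M u) = M' (Φ u) := by
    refine Lp.induction ENNReal.one_ne_top _ (fun c s hs hμs => ?_)
      (fun u v hu hv _ h1 h2 => ?_)
      (isClosed_eq (hc.comp M.continuous) (M'.continuous.comp hc))
    · rw [Lp.simpleFunc.coe_indicatorConst]
      exact Lp.ext <| (hΦ.map_mul_indicator indicatorConstLp_coeFn (hM _)).trans (hM' _).symm
    · simp only [map_add, h1, h2]
  have hhM : h = M f := Lp.ext (hh.trans (hM f).symm)
  rw [hhM, key]
  exact hM' _

variable [IsProbabilityMeasure μ']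

lemma integral_min_map (hΦ : IsMarkovEmbedding Φ) (f : Lp ℂ 1 μ) (n : ℕ) :
    ∫ x, min (n * ‖Φ f x‖) 1 ∂μ' = ∫ x, min (n * ‖f x‖) 1 ∂μ := by
  rw [integral_min_one_eq n f (Lp.const 1 μ (1 : ℂ) - (n : ℂ) • absL1 f),
    integral_min_one_eq n (Φ f) (Φ (Lp.const 1 μ (1 : ℂ) - (n : ℂ) • absL1 f)),
    hΦ.norm_map, hΦ.norm_map]
  · rw [map_sub, map_smul, hΦ.map_absL1]
    filter_upwards [Lp.coeFn_sub (Φ (Lp.const 1 μ (1 : ℂ))) ((n : ℂ) • absL1 (Φ f)),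
      Lp.coeFn_smul (n : ℂ) (absL1 (Φ f)),
      hΦ.coeFn_map_const 1, coeFn_absL1 (Φ f)] with x h1 h2 h3 h4
    simp only [h1, h2, h3, h4, Pi.sub_apply, Pi.smul_apply]
    simp
  · filter_upwards [Lp.coeFn_sub (Lp.const 1 μ (1 : ℂ)) ((n : ℂ) • absL1 f),
      Lp.coeFn_smul (n : ℂ) (absL1 f),
      Lp.coeFn_const 1 μ (1 : ℂ), coeFn_absL1 f] with x h1 h2 h3 h4
    simp only [h1, h2, h3, h4, Pi.sub_apply, Pi.smul_apply, Function.const_apply]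
    simp

lemma measure_map_ne_zero (hΦ : IsMarkovEmbedding Φ) (f : Lp ℂ 1 μ) :
    μ' {x | Φ f x ≠ 0} = μ {x | f x ≠ 0} := by
  have h := tendsto_integral_min_one (Φ f)
  simp_rw [hΦ.integral_min_map] at h
  exact (measureReal_eq_measureReal_iff).1 (tendsto_nhds_unique h (tendsto_integral_min_one f))

end IsMarkovEmbedding

end MarkovEmbedding

/-- **Markov embeddings are C*-algebra embeddings on `L^∞` and preserve supports**
(Lemma `app.l:alghom` of the paper).  Let `X, X'` be probability spaces and
`Φ : L¹(X) → L¹(X')` a Markov embedding: a linear isometry which is a lattice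
homomorphism (`|Φf| = Φ|f|`) and maps `𝟙` to `𝟙`.  Then (a) `Φ` restricts to an
isometric, multiplicative, star-preserving embedding `L^∞(X) → L^∞(X')`, and
(b) `μ{|f| > 0} = μ'{|Φf| > 0}` for every `f ∈ L¹(X)`; in particular `{f = 0}` is
`μ`-null iff `{Φf = 0}` is `μ'`-null. -/
theorem markov_embedding_algebra_hom
    {X : Type*} [MeasurableSpace X] {μ : Measure X} [IsProbabilityMeasure μ]
    {X' : Type*} [MeasurableSpace X'] {μ' : Measure X'} [IsProbabilityMeasure μ']
    (Φ : Lp ℂ 1 μ →ₗ[ℂ] Lp ℂ 1 μ')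
    (hiso : ∀ f : Lp ℂ 1 μ, ‖Φ f‖ = ‖f‖)
    (hlat : ∀ f g : Lp ℂ 1 μ, (⇑g =ᵐ[μ] fun x => (‖f x‖ : ℂ)) →
      ⇑(Φ g) =ᵐ[μ'] fun x => (‖Φ f x‖ : ℂ))
    (hone : ∀ e : Lp ℂ 1 μ, (⇑e =ᵐ[μ] fun _ => (1 : ℂ)) →
      ⇑(Φ e) =ᵐ[μ'] fun _ => (1 : ℂ)) :
    -- (a): Φ restricts to an embedding of C*-algebras L^∞(X) → L^∞(X')
    ((∀ f : Lp ℂ 1 μ, eLpNorm (⇑f) ⊤ μ < ⊤ →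
        eLpNorm (⇑(Φ f)) ⊤ μ' = eLpNorm (⇑f) ⊤ μ) ∧
     (∀ f g h : Lp ℂ 1 μ, eLpNorm (⇑f) ⊤ μ < ⊤ → eLpNorm (⇑g) ⊤ μ < ⊤ →
        (⇑h =ᵐ[μ] fun x => f x * g x) →
        ⇑(Φ h) =ᵐ[μ'] fun x => Φ f x * Φ g x) ∧
     (∀ f h : Lp ℂ 1 μ, eLpNorm (⇑f) ⊤ μ < ⊤ →
        (⇑h =ᵐ[μ] fun x => conj (f x)) →
        ⇑(Φ h) =ᵐ[μ'] fun x => conj (Φ f x))) ∧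
    -- (b): supports are preserved
    (∀ f : Lp ℂ 1 μ,
      μ {x | f x ≠ 0} = μ' {x | Φ f x ≠ 0} ∧
      (μ {x | f x = 0} = 0 ↔ μ' {x | Φ f x = 0} = 0)) := by
  have hΦ : IsMarkovEmbedding Φ := ⟨hiso, hlat, hone⟩
  refine ⟨⟨fun f _ => hΦ.eLpNorm_top_map f, fun f g h _ hg hh => hΦ.map_mul hg hh,
    fun f h _ hh => hΦ.map_conj hh⟩, fun f => ⟨(hΦ.measure_map_ne_zero f).symm, ?_⟩⟩
  rw [measure_ne_zero_eq_one_iff, measure_ne_zero_eq_one_iff, hΦ.measure_map_ne_zero]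

end
end

section
/- Let X = (X,Σ,μ) and X' = (X',Σ',μ') be probability spaces and let Φ : L¹(X) → L¹(X') be a bijective Markov embedding (a surjective linear isometry which is a lattice homomorphism with Φ𝟙 = 𝟙). Let Φ̂ : M(X) → M(X') be its unique multiplicative extension to the spaces of a.e.-equivalence classes of measurable ℂ-valued functions, extended componentwise to ℂ^d-valued functions: Φ̂(f_1, …, f_d) := (Φ̂f_1, …, Φ̂f_d). Then for every Borel measurable function F : ℂ^d → ℂ and every f = (f_1, …, f_d) ∈ M(X; ℂ^d): Φ̂(F ∘ f) = F ∘ (Φ̂f_1, …, Φ̂f_d) almost everywhere on X'. -/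
open MeasureTheory ComplexConjugate
open scoped ENNReal

noncomputable section

section MarkovExtension

open Set

variable {X : Type*} [MeasurableSpace X] {μ : Measure X}
  {X' : Type*} [MeasurableSpace X'] {μ' : Measure X'}

/-- `T` is a multiplicative map on classes of measurable functions which extends the Markov
embedding `Φ` of `L¹` spaces. -/
structure IsMarkovExtension (Φ : Lp ℂ 1 μ →ₗ[ℂ] Lp ℂ 1 μ')
    (T : (X →ₘ[μ] ℂ) → (X' →ₘ[μ'] ℂ)) : Prop where
  norm_map : ∀ f : Lp ℂ 1 μ, ‖Φ f‖ = ‖f‖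
  map_abs : ∀ f g : Lp ℂ 1 μ, (⇑g =ᵐ[μ] fun x => (‖f x‖ : ℂ)) →
    ⇑(Φ g) =ᵐ[μ'] fun x => (‖Φ f x‖ : ℂ)
  map_one : ∀ e : Lp ℂ 1 μ, (⇑e =ᵐ[μ] fun _ => (1 : ℂ)) → ⇑(Φ e) =ᵐ[μ'] fun _ => (1 : ℂ)
  extends_map : ∀ f : Lp ℂ 1 μ, T ↑f = ↑(Φ f)
  map_mul : ∀ f g : X →ₘ[μ] ℂ, T (f * g) = T f * T g

/-- `T` sends the class of the first function to the class of the second one. -/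
def MapsClass (T : (X →ₘ[μ] ℂ) → (X' →ₘ[μ'] ℂ)) (f : X → ℂ) (f' : X' → ℂ) : Prop :=
  ∃ e : X →ₘ[μ] ℂ, ⇑e =ᵐ[μ] f ∧ ⇑(T e) =ᵐ[μ'] f'

/-- `T` sends the indicator function of the first set to that of the second one. -/
def MapsSet (T : (X →ₘ[μ] ℂ) → (X' →ₘ[μ'] ℂ)) (A : Set X) (A' : Set X') : Prop :=
  MapsClass T (A.indicator 1) (A'.indicator 1)

variable {Φ : Lp ℂ 1 μ →ₗ[ℂ] Lp ℂ 1 μ'} {T : (X →ₘ[μ] ℂ) → (X' →ₘ[μ'] ℂ)}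
  {f g : X → ℂ} {f' g' : X' → ℂ} {A B : Set X} {A' B' : Set X'}

lemma mapsClass_coeFn (e : X →ₘ[μ] ℂ) : MapsClass T e (T e) :=
  ⟨e, .rfl, .rfl⟩

namespace MapsClass

lemma congr (h : MapsClass T f f') (hf : f =ᵐ[μ] g) (hf' : f' =ᵐ[μ'] g') : MapsClass T g g' :=
  let ⟨e, h1, h2⟩ := h
  ⟨e, h1.trans hf, h2.trans hf'⟩

lemma unique (h : MapsClass T f f') (h' : MapsClass T f g') : f' =ᵐ[μ'] g' := by
  obtain ⟨e, h1, h2⟩ := h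
  obtain ⟨e', h1', h2'⟩ := h'
  obtain rfl : e = e' := AEEqFun.ext (h1.trans h1'.symm)
  exact h2.symm.trans h2'

lemma exists_Lp (h : MapsClass T f f') (H : IsMarkovExtension Φ T) (hf : Integrable f μ) :
    ∃ p : Lp ℂ 1 μ, ⇑p =ᵐ[μ] f ∧ ⇑(Φ p) =ᵐ[μ'] f' := by
  obtain ⟨e, h1, h2⟩ := h
  have he : e ∈ Lp ℂ 1 μ := by
    rw [Lp.mem_Lp_iff_memLp, memLp_one_iff_integrable]
    exact hf.congr h1.symm
  refine ⟨⟨e, he⟩, h1, ?_⟩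
  have := H.extends_map ⟨e, he⟩
  rw [← this]
  exact h2

end MapsClass

namespace IsMarkovExtension

lemma mapsClass_Lp (H : IsMarkovExtension Φ T) (p : Lp ℂ 1 μ) : MapsClass T p (Φ p) :=
  ⟨p, .rfl, by rw [H.extends_map]⟩

lemma mul (H : IsMarkovExtension Φ T) (hf : MapsClass T f f') (hg : MapsClass T g g') :
    MapsClass T (fun x => f x * g x) (fun x => f' x * g' x) := by
  obtain ⟨e, h1, h2⟩ := hf
  obtain ⟨e', h1', h2'⟩ := hg
  refine ⟨e * e', (AEEqFun.coeFn_mul e e').trans (h1.mul h1'), ?_⟩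
  rw [H.map_mul]
  exact (AEEqFun.coeFn_mul _ _).trans (h2.mul h2')

lemma sub (H : IsMarkovExtension Φ T) (hf : MapsClass T f f') (hg : MapsClass T g g')
    (hfi : Integrable f μ) (hgi : Integrable g μ) :
    MapsClass T (fun x => f x - g x) (fun x => f' x - g' x) := by
  obtain ⟨p, h1, h2⟩ := hf.exists_Lp H hfi
  obtain ⟨q, h1', h2'⟩ := hg.exists_Lp H hgi
  refine (H.mapsClass_Lp (p - q)).congr ((Lp.coeFn_sub p q).trans (h1.sub h1')) ?_
  rw [map_sub]
  exact (Lp.coeFn_sub _ _).trans (h2.sub h2')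

lemma norm (H : IsMarkovExtension Φ T) (hf : MapsClass T f f') (hfi : Integrable f μ) :
    MapsClass T (fun x => (‖f x‖ : ℂ)) (fun x => (‖f' x‖ : ℂ)) := by
  obtain ⟨p, h1, h2⟩ := hf.exists_Lp H hfi
  have hi : MemLp (fun x => (‖f x‖ : ℂ)) 1 μ := memLp_one_iff_integrable.2 hfi.norm.ofReal
  have hq : ⇑(hi.toLp _) =ᵐ[μ] fun x => (‖p x‖ : ℂ) := by
    filter_upwards [hi.coeFn_toLp, h1] with x hx hx1
    rw [hx, hx1]
  refine (H.mapsClass_Lp (hi.toLp _)).congr hi.coeFn_toLp ((H.map_abs p _ hq).trans ?_)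
  filter_upwards [h2] with x hx
  rw [hx]

lemma integral_norm_eq (H : IsMarkovExtension Φ T) (hf : MapsClass T f f')
    (hfi : Integrable f μ) : ∫ x, ‖f' x‖ ∂μ' = ∫ x, ‖f x‖ ∂μ := by
  obtain ⟨p, h1, h2⟩ := hf.exists_Lp H hfi
  have := H.norm_map p
  rw [L1.norm_eq_integral_norm, L1.norm_eq_integral_norm] at this
  exact (integral_congr_ae (h2.fun_comp (‖·‖))).symm.trans (this.trans
    (integral_congr_ae (h1.fun_comp (‖·‖))))

lemma const [IsProbabilityMeasure μ] (H : IsMarkovExtension Φ T) (c : ℂ) :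
    MapsClass T (fun _ => c) (fun _ => c) := by
  have hi : MemLp (fun _ : X => (1 : ℂ)) 1 μ := memLp_const _
  have h1 := H.map_one (hi.toLp _) hi.coeFn_toLp
  refine (H.mapsClass_Lp (c • hi.toLp _)).congr ?_ ?_
  · filter_upwards [Lp.coeFn_smul c (hi.toLp _), hi.coeFn_toLp] with x hx hx1
    rw [hx, Pi.smul_apply, hx1, smul_eq_mul, mul_one]
  · rw [map_smul]
    filter_upwards [Lp.coeFn_smul c (Φ (hi.toLp _)), h1] with x hx hx1
    rw [hx, Pi.smul_apply, hx1, smul_eq_mul, mul_one]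

end IsMarkovExtension

lemma ae_eq_of_indicator_ae_eq {ν : Measure X} {s t : Set X}
    (h : s.indicator (1 : X → ℂ) =ᵐ[ν] t.indicator 1) : s =ᵐ[ν] t := by
  filter_upwards [h] with x hx
  refine propext (show x ∈ s ↔ x ∈ t from ?_)
  by_cases hs : x ∈ s <;> by_cases ht : x ∈ t <;> simp_all

namespace MapsSet

lemma congr (h : MapsSet T A A') (hA : A =ᵐ[μ] B) (hA' : A' =ᵐ[μ'] B') : MapsSet T B B' :=
  MapsClass.congr h (indicator_ae_eq_of_ae_eq_set hA) (indicator_ae_eq_of_ae_eq_set hA')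

lemma unique (h : MapsSet T A A') (h' : MapsSet T A B') : A' =ᵐ[μ'] B' :=
  ae_eq_of_indicator_ae_eq (MapsClass.unique h h')

lemma nullMeasurableSet (h : MapsSet T A A') : NullMeasurableSet A' μ' := by
  obtain ⟨e, -, h2⟩ := h
  have hm : MeasurableSet {x | T e x = 1} :=
    (T e).stronglyMeasurable.measurable (measurableSet_singleton 1)
  refine hm.nullMeasurableSet.congr (ae_eq_of_indicator_ae_eq ?_)
  filter_upwards [h2] with x hx
  by_cases hs : x ∈ A' <;> simp_all [indicator]

end MapsSet

/-- `U` is the image of the random variable `f` under the set map induced by `T`. -/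
def MapsVar {E : Type*} [MeasurableSpace E] (T : (X →ₘ[μ] ℂ) → (X' →ₘ[μ'] ℂ))
    (f : X → E) (U : X' → E) : Prop :=
  ∀ C : Set E, MeasurableSet C → MapsSet T (f ⁻¹' C) (U ⁻¹' C)

namespace MapsVar

lemma comp {E G : Type*} [MeasurableSpace E] [MeasurableSpace G] {f : X → E}
    {U : X' → E} (h : MapsVar T f U) {F : E → G} (hF : Measurable F) :
    MapsVar T (F ∘ f) (F ∘ U) :=
  fun _ hC => h _ (hF hC)

lemma congr {E : Type*} [MeasurableSpace E] {f g : X → E} {U V : X' → E}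
    (h : MapsVar T f U) (hf : f =ᵐ[μ] g) (hU : U =ᵐ[μ'] V) : MapsVar T g V :=
  fun C hC => (h C hC).congr (hf.preimage C) (hU.preimage C)

lemma unique {f : X → ℂ} {U V : X' → ℂ} (h : MapsVar T f U) (h' : MapsVar T f V) :
    U =ᵐ[μ'] V :=
  Filter.EventuallyEq.of_forall_separating_preimage MeasurableSet
    fun C hC => (h C hC).unique (h' C hC)

end MapsVar

namespace IsMarkovExtension

lemma inter (H : IsMarkovExtension Φ T) (hA : MapsSet T A A') (hB : MapsSet T B B') :
    MapsSet T (A ∩ B) (A' ∩ B') := by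
  refine (H.mul hA hB).congr (.of_eq ?_) (.of_eq ?_)
  · ext x; by_cases hx : x ∈ A <;> by_cases hx' : x ∈ B <;> simp [hx, hx']
  · ext x; by_cases hx : x ∈ A' <;> by_cases hx' : x ∈ B' <;> simp [hx, hx']

lemma ae_le_of_subset (H : IsMarkovExtension Φ T) (hA : MapsSet T A A') (hB : MapsSet T B B')
    (hAB : A ⊆ B) : A' ≤ᵐ[μ'] B' := by
  have := H.inter hA hB
  rw [inter_eq_left.2 hAB] at this
  filter_upwards [(this.unique hA).mem_iff] with x hx hxA
  exact (hx.2 hxA).2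

variable [IsProbabilityMeasure μ]

lemma integrable_indicator_one (hA : MeasurableSet A) :
    Integrable (A.indicator (1 : X → ℂ)) μ :=
  (integrable_const (1 : ℂ)).indicator hA

lemma mapsSet_univ (H : IsMarkovExtension Φ T) : MapsSet T univ univ :=
  (H.const 1).congr (by simp [← Pi.one_def]) (by simp [← Pi.one_def])

lemma compl (H : IsMarkovExtension Φ T) (hA : MeasurableSet A) (h : MapsSet T A A') :
    MapsSet T Aᶜ A'ᶜ := by
  refine (H.sub (H.const 1) h (integrable_const _) (integrable_indicator_one hA)).congr
    (.of_eq ?_) (.of_eq ?_)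
  · ext x; by_cases hx : x ∈ A <;> simp [hx]
  · ext x; by_cases hx : x ∈ A' <;> simp [hx]

lemma union (H : IsMarkovExtension Φ T) (hA : MeasurableSet A) (hB : MeasurableSet B)
    (h : MapsSet T A A') (h' : MapsSet T B B') : MapsSet T (A ∪ B) (A' ∪ B') := by
  have := H.compl (hA.compl.inter hB.compl) (H.inter (H.compl hA h) (H.compl hB h'))
  simpa [compl_inter] using this

lemma exists_mapsSet (H : IsMarkovExtension Φ T) (hA : MeasurableSet A) :
    ∃ A', MapsSet T A A' := by
  have hi : Integrable (A.indicator (1 : X → ℂ)) μ := integrable_indicator_one hA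
  have h : MapsClass T (A.indicator 1) (T (AEEqFun.mk _ hi.1)) :=
    (mapsClass_coeFn _).congr (AEEqFun.coeFn_mk _ _) .rfl
  refine ⟨{x | T (AEEqFun.mk _ hi.1) x = 1}, h.congr .rfl ?_⟩
  have hsq := (H.mul h h).congr (g := A.indicator 1) (.of_eq (by
    ext x; by_cases hx : x ∈ A <;> simp [hx])) .rfl
  filter_upwards [h.unique hsq] with x hx
  rcases eq_or_ne (T (AEEqFun.mk _ hi.1) x) 0 with h0 | h0
  · simp [indicator, h0]
  · have : T (AEEqFun.mk _ hi.1) x = 1 := by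
      apply mul_left_cancel₀ h0
      rw [mul_one]
      exact hx.symm
    simp [indicator, this]

lemma ae_nonneg_mul_sub_norm (H : IsMarkovExtension Φ T) (hg : MapsClass T g g')
    (hgi : Integrable g μ) (hA : MeasurableSet A) (h : MapsSet T A A') (c : ℂ) (r s : ℝ)
    (hle : ∀ x ∈ A, 0 ≤ s * (r - ‖g x - c‖)) :
    ∀ᵐ x ∂μ', x ∈ A' → 0 ≤ s * (r - ‖g' x - c‖) := by
  have hci : ∀ b : ℂ, Integrable (fun _ : X => b) μ := fun b => integrable_const b
  have hk := H.sub hg (H.const c) hgi (hci c)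
  have hki : Integrable (fun x => g x - c) μ := hgi.sub (hci c)
  have hn := H.norm hk hki
  have hni : Integrable (fun x => (‖g x - c‖ : ℂ)) μ := hki.norm.ofReal
  have hq := H.mul h (H.mul (H.const s) (H.sub (H.const r) hn (hci r) hni))
  have hqi : Integrable (fun x => A.indicator (1 : X → ℂ) x * (s * (r - ‖g x - c‖))) μ := by
    refine (((((hci r).sub hni).const_mul (s : ℂ))).indicator hA).congr (.of_eq ?_)
    ext x; by_cases hx : x ∈ A <;> simp [hx]
  have hq' := (H.norm hq hqi).congr (g := fun x => A.indicator (1 : X → ℂ) x *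
    (s * (r - ‖g x - c‖))) (.of_eq (by
      ext x
      by_cases hx : x ∈ A
      · have e : (s : ℂ) * (r - ‖g x - c‖) = ((s * (r - ‖g x - c‖) : ℝ) : ℂ) := by push_cast; rfl
        simp only [hx, indicator_of_mem, Pi.one_apply, one_mul]
        rw [e, Complex.norm_of_nonneg (hle x hx)]
      · simp [hx])) .rfl
  filter_upwards [hq.unique hq'] with x hx hxA
  have e : (s : ℂ) * (r - ‖g' x - c‖) = ((s * (r - ‖g' x - c‖) : ℝ) : ℂ) := by push_cast; rfl
  simp only [hxA, indicator_of_mem, Pi.one_apply, one_mul] at hx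
  rw [e] at hx
  rw [Complex.ofReal_inj.1 hx]
  exact norm_nonneg _

variable [IsProbabilityMeasure μ']

lemma measure_eq (H : IsMarkovExtension Φ T) (hA : MeasurableSet A) (h : MapsSet T A A') :
    μ' A' = μ A := by
  have key := H.integral_norm_eq h (integrable_indicator_one hA)
  have e1 : (fun x => ‖A.indicator (1 : X → ℂ) x‖) = A.indicator fun _ => (1 : ℝ) := by
    ext x; by_cases hx : x ∈ A <;> simp [hx]
  have e2 : (fun x => ‖A'.indicator (1 : X' → ℂ) x‖) = A'.indicator fun _ => (1 : ℝ) := by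
    ext x; by_cases hx : x ∈ A' <;> simp [hx]
  rw [e1, e2, integral_indicator₀ h.nullMeasurableSet, integral_indicator hA] at key
  simp only [integral_const, smul_eq_mul, mul_one, measureReal_restrict_apply_univ] at key
  exact (measureReal_eq_measureReal_iff).1 key

lemma iUnion (H : IsMarkovExtension Φ T) {A : ℕ → Set X} {A' : ℕ → Set X'}
    (hA : ∀ n, MeasurableSet (A n)) (h : ∀ n, MapsSet T (A n) (A' n)) :
    MapsSet T (⋃ n, A n) (⋃ n, A' n) := by
  have hacc : ∀ n, MeasurableSet (accumulate A n) := fun n =>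
    .biUnion (to_countable _) fun i _ => hA i
  have hacc' : ∀ n, MapsSet T (accumulate A n) (accumulate A' n) := by
    intro n
    induction n with
    | zero => simpa [accumulate] using h 0
    | succ n ih =>
      rw [accumulate_succ, accumulate_succ]
      exact H.union (hacc n) (hA _) ih (h _)
  obtain ⟨B', hB'⟩ := H.exists_mapsSet (MeasurableSet.iUnion hA)
  refine hB'.congr .rfl (ae_eq_of_ae_subset_of_measure_ge ?_ ?_ ?_ (measure_ne_top _ _)).symm
  · have := ae_all_iff.2 fun n => H.ae_le_of_subset (h n) hB' (subset_iUnion A n)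
    filter_upwards [this] with x hx hxA
    obtain ⟨n, hn⟩ := mem_iUnion.1 hxA
    exact hx n hn
  · rw [H.measure_eq (.iUnion hA) hB', measure_iUnion_eq_iSup_accumulate,
      measure_iUnion_eq_iSup_accumulate]
    simp_rw [H.measure_eq (hacc _) (hacc' _)]
    exact le_rfl
  · exact .iUnion fun n => (h n).nullMeasurableSet

/-- The `σ`-algebra of all sets whose preimages under `f` and `U` correspond to each other. -/
abbrev mapsSigma {E : Type*} (H : IsMarkovExtension Φ T) (f : X → E) (U : X' → E) :
    MeasurableSpace E where
  MeasurableSet' C := MeasurableSet (f ⁻¹' C) ∧ MapsSet T (f ⁻¹' C) (U ⁻¹' C)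
  measurableSet_empty := ⟨by simp, by simpa using H.compl .univ H.mapsSet_univ⟩
  measurableSet_compl _ h := ⟨h.1.compl, H.compl h.1 h.2⟩
  measurableSet_iUnion _ h := by
    simp only [preimage_iUnion]
    exact ⟨.iUnion fun n => (h n).1, H.iUnion (fun n => (h n).1) fun n => (h n).2⟩

lemma mapsVar_pi (H : IsMarkovExtension Φ T) {ι : Type*} {E : ι → Type*}
    [∀ i, MeasurableSpace (E i)] {f : ∀ i, X → E i} {U : ∀ i, X' → E i}
    (hf : ∀ i, Measurable (f i)) (h : ∀ i, MapsVar T (f i) (U i)) :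
    MapsVar T (fun x i => f i x) (fun x i => U i x) := by
  have : MeasurableSpace.pi ≤ H.mapsSigma (fun x i => f i x) (fun x i => U i x) := by
    refine iSup_le fun i => ?_
    rintro _ ⟨C, hC, rfl⟩
    exact ⟨hf i hC, h i C hC⟩
  exact fun _ hC => (this _ hC).2

lemma mapsSet_ball (H : IsMarkovExtension Φ T) (hg : MapsClass T g g') (hgm : Measurable g)
    (hgi : Integrable g μ) (c : ℂ) (r : ℝ) :
    MapsSet T (g ⁻¹' Metric.ball c r) (g' ⁻¹' Metric.ball c r) := by
  let A : ℕ → Set X := fun n => g ⁻¹' Metric.closedBall c (r - 1 / (n + 1 : ℝ))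
  have hA : ∀ n, MeasurableSet (A n) := fun n => hgm measurableSet_closedBall
  choose A' hA' using fun n => H.exists_mapsSet (hA n)
  have hU : ⋃ n, A n = g ⁻¹' Metric.ball c r := by
    ext x
    simp only [A, mem_iUnion, mem_preimage, Metric.mem_closedBall, Metric.mem_ball]
    constructor
    · rintro ⟨n, hn⟩
      have : (0 : ℝ) < 1 / (n + 1 : ℝ) := by positivity
      linarith
    · intro hx
      obtain ⟨n, hn⟩ := exists_nat_one_div_lt (sub_pos.2 hx)
      exact ⟨n, by linarith⟩
  have hball := H.iUnion hA hA'
  rw [hU] at hball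
  have hm : MeasurableSet (g ⁻¹' Metric.ball c r) := hgm measurableSet_ball
  refine hball.congr .rfl ?_
  have h1 : ∀ᵐ x ∂μ', ∀ n, x ∈ A' n → 0 ≤ 1 * ((r - 1 / (n + 1 : ℝ)) - ‖g' x - c‖) :=
    ae_all_iff.2 fun n => H.ae_nonneg_mul_sub_norm hg hgi (hA n) (hA' n) c _ 1 fun x hx => by
      have : dist (g x) c ≤ r - 1 / (n + 1 : ℝ) := hx
      rw [dist_eq_norm] at this
      linarith
  have h2 := H.ae_nonneg_mul_sub_norm hg hgi hm.compl (H.compl hm hball) c r (-1) fun x hx => by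
    have : ¬ dist (g x) c < r := hx
    rw [dist_eq_norm] at this
    linarith
  filter_upwards [h1, h2] with x hx1 hx2
  refine propext (show x ∈ ⋃ n, A' n ↔ dist (g' x) c < r from ?_)
  rw [dist_eq_norm]
  constructor
  · intro hx
    obtain ⟨n, hn⟩ := mem_iUnion.1 hx
    have := hx1 n hn
    have : (0 : ℝ) < 1 / (n + 1 : ℝ) := by positivity
    linarith
  · intro hx
    by_contra hc
    have := hx2 hc
    linarith

lemma mapsVar_of_integrable (H : IsMarkovExtension Φ T) (hg : MapsClass T g g')
    (hgm : Measurable g) (hgi : Integrable g μ) : MapsVar T g g' := by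
  have hbasis : TopologicalSpace.IsTopologicalBasis
      {s : Set ℂ | ∃ c r, s = Metric.ball c r} := by
    refine TopologicalSpace.isTopologicalBasis_of_isOpen_of_nhds ?_ ?_
    · rintro _ ⟨c, r, rfl⟩
      exact Metric.isOpen_ball
    · intro c u hc hu
      obtain ⟨r, hr, hru⟩ := Metric.isOpen_iff.1 hu c hc
      exact ⟨_, ⟨c, r, rfl⟩, Metric.mem_ball_self hr, hru⟩
  have hle : MeasurableSpace.generateFrom {s : Set ℂ | ∃ c r, s = Metric.ball c r} ≤
      H.mapsSigma g g' := by
    refine MeasurableSpace.generateFrom_le ?_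
    rintro _ ⟨c, r, rfl⟩
    exact ⟨hgm measurableSet_ball, H.mapsSet_ball hg hgm hgi c r⟩
  intro C hC
  rw [BorelSpace.measurable_eq (α := ℂ), hbasis.borel_eq_generateFrom] at hC
  exact (hle C hC).2

lemma mapsVar (H : IsMarkovExtension Φ T) (hg : MapsClass T g g') (hgm : Measurable g) :
    MapsVar T g g' := by
  let k : X → ℂ := fun x => ((1 + ‖g x‖ : ℝ) : ℂ)⁻¹
  have hk0 : ∀ x, k x ≠ 0 := fun x =>
    inv_ne_zero (Complex.ofReal_ne_zero.2 (by positivity))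
  have hknorm : ∀ x, ‖k x‖ = (1 + ‖g x‖)⁻¹ := fun x => by
    simp only [k]
    rw [norm_inv, Complex.norm_of_nonneg (by positivity)]
  have hkm : Measurable k := (Complex.measurable_ofReal.comp (hgm.norm.const_add 1)).inv
  have hki : Integrable k μ := .of_bound hkm.aestronglyMeasurable 1 (.of_forall fun x => by
    rw [hknorm]
    exact inv_le_one_of_one_le₀ (by linarith [norm_nonneg (g x)]))
  have hkgm : Measurable fun x => k x * g x := hkm.mul hgm
  have hkgi : Integrable (fun x => k x * g x) μ :=
    .of_bound hkgm.aestronglyMeasurable 1 (.of_forall fun x => by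
      rw [norm_mul, hknorm, inv_mul_le_one₀ (by positivity)]
      linarith)
  have hk : MapsClass T k (T (AEEqFun.mk k hki.1)) :=
    (mapsClass_coeFn _).congr (AEEqFun.coeFn_mk _ _) .rfl
  set k' : X' → ℂ := ⇑(T (AEEqFun.mk k hki.1))
  have hkv := H.mapsVar_of_integrable hk hkm hki
  have hkgv := H.mapsVar_of_integrable (H.mul hk hg) hkgm hkgi
  have hk'0 : ∀ᵐ x ∂μ', k' x ≠ 0 := by
    have h0 := hkv {0}ᶜ (measurableSet_singleton 0).compl
    rw [show k ⁻¹' {0}ᶜ = univ from eq_univ_of_forall hk0] at h0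
    filter_upwards [(h0.unique H.mapsSet_univ).mem_iff] with x hx
    exact hx.2 trivial
  have hpair := H.mapsVar_pi (f := ![k, fun x => k x * g x])
    (U := ![k', fun x => k' x * g' x]) (Fin.forall_fin_two.2 ⟨hkm, hkgm⟩)
    (Fin.forall_fin_two.2 ⟨hkv, hkgv⟩)
  have hF : Measurable fun z : Fin 2 → ℂ => z 1 / z 0 :=
    (measurable_pi_apply 1).div (measurable_pi_apply 0)
  refine (MapsVar.comp hpair hF).congr (.of_forall fun x => ?_) ?_
  · simp [mul_div_cancel_left₀ _ (hk0 x)]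
  · filter_upwards [hk'0] with x hx
    simp [mul_div_cancel_left₀ _ hx]

end IsMarkovExtension

end MarkovExtension

/-- **Markov isomorphisms commute with Borel functional calculus**
(Theorem `embed.t:fc-gen` of the paper).  Let `Φ : L¹(X) → L¹(X')` be a bijective
Markov embedding between probability spaces and `Φ̂ : M(X) → M(X')` its canonical
(unique multiplicative) extension to a.e.-equivalence classes of measurable ℂ-valued
functions, extended componentwise to `ℂ^d`-valued functions.  Then
`Φ̂(F ∘ f) = F ∘ (Φ̂f₁, …, Φ̂f_d)` almost everywhere, for every Borel measurable
`F : ℂ^d → ℂ` and every `f ∈ M(X; ℂ^d)`. -/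
theorem markov_isomorphism_functional_calculus
    {X : Type*} [MeasurableSpace X] {μ : Measure X} [IsProbabilityMeasure μ]
    {X' : Type*} [MeasurableSpace X'] {μ' : Measure X'} [IsProbabilityMeasure μ']
    (Φ : Lp ℂ 1 μ →ₗ[ℂ] Lp ℂ 1 μ')
    (hiso : ∀ f : Lp ℂ 1 μ, ‖Φ f‖ = ‖f‖)
    (hlat : ∀ f g : Lp ℂ 1 μ, (⇑g =ᵐ[μ] fun x => (‖f x‖ : ℂ)) →
      ⇑(Φ g) =ᵐ[μ'] fun x => (‖Φ f x‖ : ℂ))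
    (hone : ∀ e : Lp ℂ 1 μ, (⇑e =ᵐ[μ] fun _ => (1 : ℂ)) →
      ⇑(Φ e) =ᵐ[μ'] fun _ => (1 : ℂ))
    (hbij : Function.Bijective ⇑Φ)
    (Φhat : (X →ₘ[μ] ℂ) → (X' →ₘ[μ'] ℂ))
    (hext : ∀ f : Lp ℂ 1 μ, Φhat ↑f = ↑(Φ f))
    (hmul : ∀ f g : X →ₘ[μ] ℂ, Φhat (f * g) = Φhat f * Φhat g)
    (d : ℕ) (F : (Fin d → ℂ) → ℂ) (hF : Measurable F)
    (f : X → Fin d → ℂ) (hf : Measurable f)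
    (u : Fin d → X →ₘ[μ] ℂ) (hu : ∀ i, ⇑(u i) =ᵐ[μ] fun x => f x i)
    (w : X →ₘ[μ] ℂ) (hw : ⇑w =ᵐ[μ] fun x => F (f x)) :
    ⇑(Φhat w) =ᵐ[μ'] fun x => F (fun i => Φhat (u i) x) := by
  have H : IsMarkovExtension Φ Φhat := ⟨hiso, hlat, hone, hext, hmul⟩
  have hu' : MapsVar Φhat f (fun x i => Φhat (u i) x) :=
    H.mapsVar_pi (f := fun i x => f x i) (U := fun i => ⇑(Φhat (u i)))
      (fun i => (measurable_pi_apply i).comp hf) fun i =>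
      H.mapsVar ((mapsClass_coeFn (u i)).congr (hu i) .rfl) ((measurable_pi_apply i).comp hf)
  have hw' : MapsVar Φhat (F ∘ f) (Φhat w) :=
    H.mapsVar ((mapsClass_coeFn w).congr hw .rfl) (hF.comp hf)
  exact hw'.unique (hu'.comp hF)

end
end
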